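/- Let k be a field, V a finite-dimensional k-vector space, b a nondegenerate alternating bilinear form on V, W ⊆ V a subspace, W' = W + W^⊥, and W₀ = W ∩ W^⊥. Then W'^⊥ = W₀; the form b induces a well-defined alternating form b' on the quotient W'/W₀; the images of W and of W^⊥ in W'/W₀ are complementary subspaces that are b'-orthogonal to each other; and the restriction of b' to each of these two images is nondegenerate. -/

import Mathlib

/-- The orthogonal complement `U^⊥ = {x : V | b (x, u) = 0 for all u ∈ U}` of a submodule `U`
with respect to a bilinear form `b`. -/
def perp {k V : Type*} [Field k] [AddCommGroup V] [Module k V]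
    (b : V →ₗ[k] V →ₗ[k] k) (U : Submodule k V) : Submodule k V where
  carrier := {x : V | ∀ u ∈ U, b x u = 0}
  add_mem' := by
    intro x y hx hy
    simp only [Set.mem_setOf_eq] at *
    intro u hu
    rw [map_add, LinearMap.add_apply, hx u hu, hy u hu, add_zero]
  zero_mem' := by
    simp only [Set.mem_setOf_eq]
    intro u hu
    simp
  smul_mem' := by
    intro c x hx
    simp only [Set.mem_setOf_eq] at *
    intro u hu
    rw [map_smul, LinearMap.smul_apply, hx u hu, smul_zero]

variable {k V : Type*} [Field k] [AddCommGroup V] [Module k V]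

/-- `W' = W + W^⊥`. -/
abbrev WPlus (b : V →ₗ[k] V →ₗ[k] k) (W : Submodule k V) : Submodule k V :=
  W ⊔ perp b W

/-- `W₀ = W ∩ W^⊥`, viewed as a submodule of `W' = W + W^⊥`. -/
abbrev WZero (b : V →ₗ[k] V →ₗ[k] k) (W : Submodule k V) : Submodule k ↥(WPlus b W) :=
  (W ⊓ perp b W).comap (WPlus b W).subtype

/-- The quotient `W'/W₀`. -/
abbrev QuotWPlus (b : V →ₗ[k] V →ₗ[k] k) (W : Submodule k V) :=
  ↥(WPlus b W) ⧸ WZero b W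

/-- The image of `W` in `W'/W₀`. -/
abbrev imageW (b : V →ₗ[k] V →ₗ[k] k) (W : Submodule k V) :
    Submodule k (QuotWPlus b W) :=
  Submodule.map (WZero b W).mkQ (W.comap (WPlus b W).subtype)

/-- The image of `W^⊥` in `W'/W₀`. -/
abbrev imageWPerp (b : V →ₗ[k] V →ₗ[k] k) (W : Submodule k V) :
    Submodule k (QuotWPlus b W) :=
  Submodule.map (WZero b W).mkQ ((perp b W).comap (WPlus b W).subtype)

section Perp

variable {b : V →ₗ[k] V →ₗ[k] k} {U W : Submodule k V}

theorem perp_sup : perp b (U ⊔ W) = perp b U ⊓ perp b W := by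
  ext x
  refine ⟨fun h => ⟨fun u hu => h u (Submodule.mem_sup_left hu),
    fun w hw => h w (Submodule.mem_sup_right hw)⟩, ?_⟩
  rintro ⟨hU, hW⟩ y hy
  obtain ⟨u, hu, w, hw, rfl⟩ := Submodule.mem_sup.mp hy
  rw [map_add, hU u hu, hW w hw, add_zero]

theorem perp_eq_orthogonal (hb : b.IsRefl) :
    perp b U = LinearMap.BilinForm.orthogonal b U := by
  ext x
  exact ⟨fun h u hu => hb _ _ (h u hu), fun h u hu => hb _ _ (h u hu)⟩

theorem perp_perp [FiniteDimensional k V] (hb : b.IsRefl) (hnd : b.SeparatingLeft) :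
    perp b (perp b U) = U := by
  rw [perp_eq_orthogonal hb, perp_eq_orthogonal hb]
  exact LinearMap.BilinForm.orthogonal_orthogonal
    (hb.nondegenerate_iff_separatingLeft.mpr hnd) hb U

theorem perp_wPlus [FiniteDimensional k V] (hb : b.IsRefl) (hnd : b.SeparatingLeft) :
    perp b (WPlus b W) = W ⊓ perp b W := by
  rw [perp_sup, perp_perp hb hnd, inf_comm]

/-- The form on `W'/W₀` induced by a reflexive form `b`, where `W₀ = W ∩ W^⊥` is orthogonal
to `W' = W + W^⊥`. -/
def quotForm (hb : b.IsRefl) (h₀ : W ⊓ perp b W ≤ perp b (WPlus b W)) :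
    QuotWPlus b W →ₗ[k] QuotWPlus b W →ₗ[k] k :=
  (b.domRestrict₁₂ (WPlus b W) (WPlus b W)).liftQ₂ (WZero b W) (WZero b W)
    (fun _ hx => LinearMap.ext fun y => h₀ hx y y.2)
    (fun _ hy => LinearMap.ext fun x => hb _ _ (h₀ hy x x.2))

theorem quotForm_mk (hb : b.IsRefl) (h₀ : W ⊓ perp b W ≤ perp b (WPlus b W))
    (x y : WPlus b W) :
    quotForm hb h₀ (Submodule.Quotient.mk x) (Submodule.Quotient.mk y) = b (x : V) (y : V) :=
  rfl

theorem isCompl_imageW_imageWPerp : IsCompl (imageW b W) (imageWPerp b W) := by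
  refine ⟨Submodule.disjoint_def.mpr ?_, codisjoint_iff_le_sup.mpr ?_⟩
  · rintro _ ⟨x, hx, rfl⟩ ⟨y, hy, hxy⟩
    have hsub : (y : V) - x ∈ W ⊓ perp b W := (Submodule.Quotient.eq (WZero b W)).mp hxy
    refine (Submodule.Quotient.mk_eq_zero (WZero b W)).mpr ⟨hx, ?_⟩
    simpa using (perp b W).sub_mem hy hsub.2
  · intro u _
    obtain ⟨⟨_, hz⟩, rfl⟩ := (WZero b W).mkQ_surjective u
    obtain ⟨w, hw, p, hp, rfl⟩ := Submodule.mem_sup.mp hz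
    exact Submodule.mem_sup.mpr
      ⟨_, ⟨⟨w, Submodule.mem_sup_left hw⟩, hw, rfl⟩,
        _, ⟨⟨p, Submodule.mem_sup_right hp⟩, hp, rfl⟩, rfl⟩

end Perp

/-- Let `b` be a nondegenerate alternating form on a finite-dimensional vector
space `V`, let `W ⊆ V` be a subspace, `W' = W + W^⊥` and `W₀ = W ∩ W^⊥`.  Then `W'^⊥ = W₀`; the
form `b` induces a well-defined alternating form `b'` on `W'/W₀`; the images of `W` and `W^⊥` in
`W'/W₀` are complementary and `b'`-orthogonal to each other; and `b'` restricts nondegenerately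
to each of these two images. -/
theorem statement8 [FiniteDimensional k V]
    (b : V →ₗ[k] V →ₗ[k] k)
    (halt : ∀ x : V, b x x = 0)
    (hnd : ∀ x : V, (∀ y : V, b x y = 0) → x = 0)
    (W : Submodule k V) :
    perp b (W ⊔ perp b W) = W ⊓ perp b W ∧
    ∃ b' : QuotWPlus b W →ₗ[k] QuotWPlus b W →ₗ[k] k,
      (∀ x y : ↥(WPlus b W),
        b' (Submodule.Quotient.mk x) (Submodule.Quotient.mk y) = b (x : V) (y : V)) ∧
      (∀ u : QuotWPlus b W, b' u u = 0) ∧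
      IsCompl (imageW b W) (imageWPerp b W) ∧
      (∀ u ∈ imageW b W, ∀ v ∈ imageWPerp b W, b' u v = 0) ∧
      (∀ u ∈ imageW b W, (∀ v ∈ imageW b W, b' u v = 0) → u = 0) ∧
      (∀ u ∈ imageWPerp b W, (∀ v ∈ imageWPerp b W, b' u v = 0) → u = 0) := by
  have hb : b.IsRefl := LinearMap.IsAlt.isRefl halt
  have h₀ : perp b (WPlus b W) = W ⊓ perp b W := perp_wPlus hb hnd
  refine ⟨h₀, quotForm hb h₀.ge, quotForm_mk hb h₀.ge, ?_, isCompl_imageW_imageWPerp, ?_, ?_, ?_⟩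
  · intro u
    obtain ⟨x, rfl⟩ := (WZero b W).mkQ_surjective u
    exact halt x
  · rintro _ ⟨x, hx, rfl⟩ _ ⟨y, hy, rfl⟩
    exact hb _ _ (hy x hx)
  · rintro _ ⟨x, hx, rfl⟩ h
    exact (Submodule.Quotient.mk_eq_zero (WZero b W)).mpr
      ⟨hx, fun w hw => h _ ⟨⟨w, Submodule.mem_sup_left hw⟩, hw, rfl⟩⟩
  · rintro _ ⟨x, hx, rfl⟩ h
    have hxW : (x : V) ∈ perp b (perp b W) :=
      fun p hp => h _ ⟨⟨p, Submodule.mem_sup_right hp⟩, hp, rfl⟩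
    rw [perp_perp hb hnd] at hxW
    exact (Submodule.Quotient.mk_eq_zero (WZero b W)).mpr ⟨hxW, hx⟩
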